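/- Let H ≥ 1 and K ≥ 1 be integers and let n : ℕ → ℕ be a nondecreasing sequence such that n_k − n_{k−1} ≤ H for every 1 ≤ k ≤ K. Then Σ_{k=1}^K (n_k − n_{k−1}) / √(max(n_{k−1}, 1)) ≤ 2H + √(2·K·H·log(max(n_K, 1))). -/

import Mathlib

open Finset

/-- The increments of a nondecreasing counter started below the threshold `H` total at most
`2 * H`, and never more than the current value. -/
lemma sum_increment_below_threshold_le (H : ℕ) (n : ℕ → ℕ) (hmono : Monotone n) (K : ℕ)
    (hinc : ∀ k < K, n (k + 1) ≤ n k + H) :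
    (∑ k ∈ range K, if n k < H then (n (k + 1) : ℝ) - n k else 0) ≤ n K ∧
      (∑ k ∈ range K, if n k < H then (n (k + 1) : ℝ) - n k else 0) ≤ 2 * H := by
  induction K with
  | zero => simp
  | succ K ih =>
    obtain ⟨h1, h2⟩ := ih fun k hk => hinc k (by omega)
    rw [sum_range_succ]
    have hm : (n K : ℝ) ≤ n (K + 1) := by exact_mod_cast hmono K.le_succ
    have hd : (n (K + 1) : ℝ) ≤ n K + H := by exact_mod_cast hinc K (by omega)
    split_ifs with h
    · have h' : (n K : ℝ) < H := by exact_mod_cast h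
      constructor <;> linarith
    · constructor <;> linarith

/-- A relative increment of size at most one is at most twice the logarithmic increment. -/
lemma sub_div_le_two_mul_log_sub_log {a b : ℝ} (ha : 0 < a) (hab : a ≤ b) (hba : b ≤ 2 * a) :
    (b - a) / a ≤ 2 * (Real.log b - Real.log a) := by
  have hb : 0 < b := ha.trans_le hab
  have hlog := Real.one_sub_inv_le_log_of_pos (div_pos hb ha)
  rw [Real.log_div hb.ne' ha.ne', inv_div] at hlog
  have key : (b - a) / a ≤ 2 * (1 - a / b) := by
    rw [one_sub_div hb.ne', ← mul_div_assoc, div_le_div_iff₀ ha hb]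
    nlinarith
  linarith

/-- The relative increments above the threshold `H` sum to at most twice the logarithm of the
final value. -/
lemma sum_relative_increment_le_two_mul_log (H : ℕ) (hH : 1 ≤ H) (n : ℕ → ℕ)
    (hmono : Monotone n) (K : ℕ) (hinc : ∀ k < K, n (k + 1) ≤ n k + H) :
    (∑ k ∈ range K, if n k < H then 0 else ((n (k + 1) : ℝ) - n k) / n k) ≤
      2 * Real.log ((max (n K) 1 : ℕ) : ℝ) := by
  induction K with
  | zero =>
    have : (0 : ℝ) ≤ Real.log ((max (n 0) 1 : ℕ) : ℝ) := Real.log_natCast_nonneg _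
    simpa using this
  | succ K ih =>
    have ih := ih fun k hk => hinc k (by omega)
    have hm : n K ≤ n (K + 1) := hmono K.le_succ
    have hd := hinc K (by omega)
    rw [sum_range_succ]
    split_ifs with h
    · have : Real.log ((max (n K) 1 : ℕ) : ℝ) ≤ Real.log ((max (n (K + 1)) 1 : ℕ) : ℝ) := by
        apply Real.log_le_log
        · exact_mod_cast (by omega : 0 < max (n K) 1)
        · exact_mod_cast max_le_max_right 1 hm
      linarith
    · rw [max_eq_left (by omega : 1 ≤ n K)] at ih
      rw [max_eq_left (by omega : 1 ≤ n (K + 1))]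
      have := sub_div_le_two_mul_log_sub_log (a := n K) (b := n (K + 1))
        (by exact_mod_cast (by omega : 0 < n K)) (by exact_mod_cast hm)
        (by exact_mod_cast (by omega : n (K + 1) ≤ 2 * n K))
      linarith

/-- Deterministic bound inside the proof of the Expected Cumulative Visitation Bound
(Lemma F.1): for a nondecreasing counter `n` with per-step increments at most `H`,
`Σ_{k=1}^K (n_k - n_{k-1}) / √(max(n_{k-1},1)) ≤ 2H + √(2·K·H·log(max(n_K,1)))`. -/
theorem cumulative_visitation_sqrt_bound
    (H K : ℕ) (hH : 1 ≤ H) (hK : 1 ≤ K)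
    (n : ℕ → ℕ) (hmono : Monotone n)
    (hinc : ∀ k, 1 ≤ k → k ≤ K → n k - n (k - 1) ≤ H) :
    ∑ k ∈ Finset.Icc 1 K,
        ((n k : ℝ) - (n (k - 1) : ℝ)) / Real.sqrt ((max (n (k - 1)) 1 : ℕ) : ℝ)
      ≤ 2 * H + Real.sqrt (2 * K * H * Real.log ((max (n K) 1 : ℕ) : ℝ)) := by
  have hinc' : ∀ k < K, n (k + 1) ≤ n k + H := fun k hk => by
    have := hinc (k + 1) (by omega) (by omega)
    rw [Nat.add_sub_cancel] at this
    omega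
  rw [← Ico_add_one_right_eq_Icc, sum_Ico_eq_sum_range]
  simp only [Nat.add_sub_cancel, Nat.add_comm 1]
  set b : ℕ → ℝ := fun k =>
    if n k < H then 0 else ((n (k + 1) : ℝ) - n k) / Real.sqrt (n k) with hb
  have hsq : (∑ k ∈ range K, b k) ^ 2 ≤ 2 * K * H * Real.log ((max (n K) 1 : ℕ) : ℝ) := by
    calc (∑ k ∈ range K, b k) ^ 2 ≤ K * ∑ k ∈ range K, b k ^ 2 := by
          simpa using sq_sum_le_card_mul_sum_sq (s := range K) (f := b)
      _ ≤ K * ∑ k ∈ range K, H * (if n k < H then 0 else ((n (k + 1) : ℝ) - n k) / n k) := by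
          gcongr with k hk
          have hm : (n k : ℝ) ≤ n (k + 1) := by exact_mod_cast hmono k.le_succ
          have hd : (n (k + 1) : ℝ) ≤ n k + H := by exact_mod_cast hinc' k (mem_range.mp hk)
          simp only [hb]
          split_ifs
          · simp
          · rw [div_pow, Real.sq_sqrt (Nat.cast_nonneg _), ← mul_div_assoc]
            gcongr
            nlinarith
      _ ≤ K * (H * (2 * Real.log ((max (n K) 1 : ℕ) : ℝ))) := by
          rw [← mul_sum]
          gcongr
          exact sum_relative_increment_le_two_mul_log H hH n hmono K hinc'
      _ = _ := by ring
  refine le_trans ?_ (add_le_add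
    (sum_increment_below_threshold_le H n hmono K hinc').2 (Real.le_sqrt_of_sq_le hsq))
  rw [← sum_add_distrib]
  refine sum_le_sum fun k _ => ?_
  have hm : (n k : ℝ) ≤ n (k + 1) := by exact_mod_cast hmono k.le_succ
  simp only [hb]
  split_ifs with h
  · rw [add_zero]
    refine div_le_self (sub_nonneg.mpr hm) (Real.one_le_sqrt.mpr ?_)
    exact_mod_cast le_max_right (n k) 1
  · rw [zero_add, max_eq_left (by omega : 1 ≤ n k)]
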